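/- Let x^(1) = (1, 4, 2, 3) and x^(2) = (4, 2, 4, 5), and let F(z) = dtw(z, x^(1))² + dtw(z, x^(2))². For every warping path p = (p_1, …, p_L) of order 4 × 4, let x̄_p denote the length-L time series whose ℓ-th element is (x^(1)_{i_ℓ} + x^(2)_{j_ℓ})/2, where p_ℓ = (i_ℓ, j_ℓ). Then F(x̄_p) > 6.5 = F((2.5, 4, 2, 4)) for every warping path p of order 4 × 4; that is, no column-wise average along any warping path between x^(1) and x^(2) is a mean of the sample. -/

import Mathlib

/-- A warping path of order `m × n` (pairs are 1-indexed): it starts at `(1,1)`,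
ends at `(m,n)`, stays within `[m] × [n]`, and each step is one of
`(+1,0)`, `(0,+1)`, `(+1,+1)`. -/
def IsWarpingPath (m n : ℕ) (p : List (ℕ × ℕ)) : Prop :=
  p.head? = some (1, 1) ∧
  p.getLast? = some (m, n) ∧
  (∀ q ∈ p, 1 ≤ q.1 ∧ q.1 ≤ m ∧ 1 ≤ q.2 ∧ q.2 ≤ n) ∧
  ∀ ℓ : ℕ, ℓ + 1 < p.length →
    ((p.getD (ℓ + 1) (0, 0)).1 = (p.getD ℓ (0, 0)).1 + 1 ∧
       (p.getD (ℓ + 1) (0, 0)).2 = (p.getD ℓ (0, 0)).2) ∨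
    ((p.getD (ℓ + 1) (0, 0)).1 = (p.getD ℓ (0, 0)).1 ∧
       (p.getD (ℓ + 1) (0, 0)).2 = (p.getD ℓ (0, 0)).2 + 1) ∨
    ((p.getD (ℓ + 1) (0, 0)).1 = (p.getD ℓ (0, 0)).1 + 1 ∧
       (p.getD (ℓ + 1) (0, 0)).2 = (p.getD ℓ (0, 0)).2 + 1)

/-- The cost `C_p(x,y)` of aligning time series `x` and `y` (1-indexed, given as
lists of rationals) along the warping path `p`. -/
def alignCost (x y : List ℚ) (p : List (ℕ × ℕ)) : ℚ :=
  (p.map fun q => (x.getD (q.1 - 1) 0 - y.getD (q.2 - 1) 0) ^ 2).sum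

/-- The squared dtw-distance: the minimum alignment cost over all warping paths
of order `x.length × y.length`. -/
noncomputable def dtwSq (x y : List ℚ) : ℝ :=
  sInf {c : ℝ | ∃ p : List (ℕ × ℕ),
    IsWarpingPath x.length y.length p ∧ c = (alignCost x y p : ℝ)}

/-- The dtw-distance. -/
noncomputable def dtw (x y : List ℚ) : ℝ := Real.sqrt (dtwSq x y)

/-- The first sample time series `x⁽¹⁾ = (1,4,2,3)`. -/
def xOne : List ℚ := [1, 4, 2, 3]

/-- The second sample time series `x⁽²⁾ = (4,2,4,5)`. -/
def xTwo : List ℚ := [4, 2, 4, 5]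

/-- The Fréchet function of the sample `(x⁽¹⁾, x⁽²⁾)`. -/
noncomputable def F (z : List ℚ) : ℝ := dtwSq z xOne + dtwSq z xTwo

/-- The column-wise average of `x⁽¹⁾` and `x⁽²⁾` along the warping path `p`. -/
def colAverage (p : List (ℕ × ℕ)) : List ℚ :=
  p.map fun q => (xOne.getD (q.1 - 1) 0 + xTwo.getD (q.2 - 1) 0) / 2

/-- The admissible steps of a warping path. -/
def WarpingStep (q r : ℕ × ℕ) : Prop :=
  (r.1 = q.1 + 1 ∧ r.2 = q.2) ∨ (r.1 = q.1 ∧ r.2 = q.2 + 1) ∨ (r.1 = q.1 + 1 ∧ r.2 = q.2 + 1)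

theorem isWarpingPath_iff_isChain {m n : ℕ} {p : List (ℕ × ℕ)} :
    IsWarpingPath m n p ↔ p.head? = some (1, 1) ∧ p.getLast? = some (m, n) ∧
      (∀ q ∈ p, 1 ≤ q.1 ∧ q.1 ≤ m ∧ 1 ≤ q.2 ∧ q.2 ≤ n) ∧ p.IsChain WarpingStep := by
  unfold IsWarpingPath
  refine and_congr_right fun _ => and_congr_right fun _ => and_congr_right fun _ => ?_
  rw [List.isChain_iff_getElem]
  refine forall_congr' fun ℓ => forall_congr' fun h => ?_
  rw [List.getD_eq_getElem _ _ h, List.getD_eq_getElem _ _ (by omega : ℓ < p.length)]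
  rfl

/-- A warping path can be prolonged by an admissible step. -/
theorem IsWarpingPath.concat {m n m' n' : ℕ} {p : List (ℕ × ℕ)} (hp : IsWarpingPath m n p)
    (h : WarpingStep (m, n) (m', n')) : IsWarpingPath m' n' (p ++ [(m', n')]) := by
  rw [isWarpingPath_iff_isChain] at hp ⊢
  obtain ⟨hhead, hlast, hmem, hchain⟩ := hp
  have hmn := hmem _ (List.mem_of_getLast? hlast)
  simp only [WarpingStep] at h
  refine ⟨by simp [hhead], by simp, fun q hq => ?_, ?_⟩
  · rcases List.mem_append.1 hq with hq | hq
    · have := hmem q hq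
      omega
    · obtain rfl : q = (m', n') := by simpa using hq
      dsimp only at hmn ⊢
      omega
  · rw [List.isChain_append]
    refine ⟨hchain, List.isChain_singleton _, fun a ha b hb => ?_⟩
    rw [hlast] at ha
    simp only [Option.mem_def, Option.some.injEq, List.head?_cons] at ha hb
    subst ha hb
    exact h

theorem exists_isWarpingPath (m n : ℕ) : ∃ p, IsWarpingPath (m + 1) (n + 1) p := by
  induction m with
  | zero =>
    induction n with
    | zero => exact ⟨[(1, 1)], by simp [isWarpingPath_iff_isChain]⟩
    | succ n ih =>
      obtain ⟨p, hp⟩ := ih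
      exact ⟨_, hp.concat (Or.inr (Or.inl ⟨rfl, rfl⟩))⟩
  | succ m ih =>
    obtain ⟨p, hp⟩ := ih
    exact ⟨_, hp.concat (Or.inl ⟨rfl, rfl⟩)⟩

/-- The minimal total cost, with respect to the local cost `c`, of the first `k + 1` entries of
a path from `(i, j)` to `(m, n)` with admissible steps. -/
def minCost (c : ℕ → ℕ → ℕ) (m n : ℕ) : ℕ → ℕ → ℕ → ℕ
  | 0, i, j => c i j
  | k + 1, i, j =>
    if i < m then
      if j < n then
        c i j + min (minCost c m n k (i + 1) j)
          (min (minCost c m n k i (j + 1)) (minCost c m n k (i + 1) (j + 1)))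
      else c i j + minCost c m n k (i + 1) j
    else if j < n then c i j + minCost c m n k i (j + 1)
    else c i j

theorem minCost_le_sum {c : ℕ → ℕ → ℕ} {m n : ℕ} (k : ℕ) (q : ℕ × ℕ)
    (t : List (ℕ × ℕ)) (hlast : (q :: t).getLast? = some (m, n))
    (hmem : ∀ r ∈ q :: t, r.1 ≤ m ∧ r.2 ≤ n) (hchain : (q :: t).IsChain WarpingStep) :
    minCost c m n k q.1 q.2 ≤ ((q :: t).map fun r => c r.1 r.2).sum := by
  induction t generalizing k q with
  | nil =>
    obtain rfl : q = (m, n) := by simpa using hlast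
    cases k <;> simp [minCost]
  | cons r t ih =>
    have hq := hmem q (by simp)
    have hr := hmem r (by simp)
    rw [List.isChain_cons_cons] at hchain
    cases k with
    | zero => simp [minCost]
    | succ k =>
      have ih := ih k r (by simpa using hlast)
        (fun s hs => hmem s (List.mem_cons_of_mem _ hs)) hchain.2
      rw [List.map_cons, List.sum_cons]
      obtain ⟨r₁, r₂⟩ := r
      rcases hchain.1 with ⟨h₁, h₂⟩ | ⟨h₁, h₂⟩ | ⟨h₁, h₂⟩ <;> dsimp only at h₁ h₂ hr ih <;>
        subst h₁ h₂ <;> rw [minCost] <;> split_ifs <;> omega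

/-- The time series whose entries are half of those of an integer list. -/
def halve (X : List ℤ) : List ℚ := X.map fun a : ℤ => (a : ℚ) / 2

theorem getD_halve (X : List ℤ) (i : ℕ) : (halve X).getD i 0 = (X.getD i 0 : ℤ) / 2 := by
  have := List.getD_map (l := X) (d := 0) (n := i) (fun a : ℤ => (a : ℚ) / 2)
  simpa [halve] using this

/-- A computable lower bound of four times the squared dtw-distance of `halve X` and `halve Y`. -/
def dtwBound (X Y : List ℤ) : ℕ :=
  minCost (fun i j => (X.getD (i - 1) 0 - Y.getD (j - 1) 0).natAbs ^ 2) X.length Y.length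
    (X.length + Y.length) 1 1

theorem alignCost_halve (X Y : List ℤ) (p : List (ℕ × ℕ)) :
    alignCost (halve X) (halve Y) p =
      ((p.map fun q => (X.getD (q.1 - 1) 0 - Y.getD (q.2 - 1) 0).natAbs ^ 2).sum : ℕ) / 4 := by
  unfold alignCost
  induction p with
  | nil => simp
  | cons q p ih =>
    rw [List.map_cons, List.sum_cons, ih, List.map_cons, List.sum_cons, getD_halve, getD_halve]
    push_cast [Nat.cast_natAbs, sq_abs]
    ring

theorem dtwBound_le_alignCost {X Y : List ℤ} {p : List (ℕ × ℕ)}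
    (hp : IsWarpingPath X.length Y.length p) :
    (dtwBound X Y : ℚ) / 4 ≤ alignCost (halve X) (halve Y) p := by
  obtain ⟨hhead, hlast, hmem, hchain⟩ := isWarpingPath_iff_isChain.1 hp
  obtain ⟨t, rfl⟩ := List.head?_eq_some_iff.1 hhead
  rw [alignCost_halve]
  gcongr
  exact minCost_le_sum _ (1, 1) _ hlast (fun r hr => ⟨(hmem r hr).2.1, (hmem r hr).2.2.2⟩) hchain

theorem dtwBound_le_dtwSq {X Y : List ℤ} (hX : X ≠ []) (hY : Y ≠ []) :
    (dtwBound X Y : ℝ) / 4 ≤ dtwSq (halve X) (halve Y) := by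
  have hlen (Z : List ℤ) : (halve Z).length = Z.length := List.length_map _
  unfold dtwSq
  rw [hlen, hlen]
  refine le_csInf ?_ ?_
  · obtain ⟨p, hp⟩ := exists_isWarpingPath (X.length - 1) (Y.length - 1)
    rw [Nat.sub_add_cancel (List.length_pos_iff.2 hX),
      Nat.sub_add_cancel (List.length_pos_iff.2 hY)] at hp
    exact ⟨_, p, hp, rfl⟩
  · rintro _ ⟨p, hp, rfl⟩
    have h := (Rat.cast_le (K := ℝ)).2 (dtwBound_le_alignCost hp)
    push_cast at h
    exact h

theorem dtwSq_le_alignCost {x y : List ℚ} {p : List (ℕ × ℕ)}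
    (hp : IsWarpingPath x.length y.length p) : dtwSq x y ≤ alignCost x y p := by
  refine csInf_le ⟨0, ?_⟩ ⟨p, hp, rfl⟩
  rintro _ ⟨p', -, rfl⟩
  refine Rat.cast_nonneg.2 (List.sum_nonneg fun a ha => ?_)
  obtain ⟨q, -, rfl⟩ := List.mem_map.1 ha
  exact sq_nonneg _

/-- The paths from `q` to `(m, n)` with admissible steps and at most `k` entries. -/
def pathsFrom (m n : ℕ) : ℕ → ℕ × ℕ → List (List (ℕ × ℕ))
  | 0, _ => []
  | k + 1, q =>
    if q = (m, n) then [[q]]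
    else if q.1 ≤ m ∧ q.2 ≤ n then
      (pathsFrom m n k (q.1 + 1, q.2) ++ pathsFrom m n k (q.1, q.2 + 1) ++
        pathsFrom m n k (q.1 + 1, q.2 + 1)).map (q :: ·)
    else []

theorem mem_pathsFrom {m n : ℕ} (k : ℕ) (q : ℕ × ℕ) (t : List (ℕ × ℕ))
    (hk : m + n < k + q.1 + q.2) (hlast : (q :: t).getLast? = some (m, n))
    (hmem : ∀ r ∈ q :: t, r.1 ≤ m ∧ r.2 ≤ n) (hchain : (q :: t).IsChain WarpingStep) :
    q :: t ∈ pathsFrom m n k q := by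
  induction t generalizing k q with
  | nil =>
    obtain rfl : q = (m, n) := by simpa using hlast
    cases k with
    | zero => dsimp only at hk; omega
    | succ k => simp [pathsFrom]
  | cons r t ih =>
    have hq := hmem q (by simp)
    have hr := hmem r (by simp)
    rw [List.isChain_cons_cons] at hchain
    have hstep := hchain.1
    unfold WarpingStep at hstep
    cases k with
    | zero => omega
    | succ k =>
      have ih := ih k r (by omega) (by simpa using hlast)
        (fun s hs => hmem s (List.mem_cons_of_mem _ hs)) hchain.2
      have hne : q ≠ (m, n) := by
        rintro rfl
        dsimp only at hstep
        omega
      rw [pathsFrom, if_neg hne, if_pos hq]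
      refine List.mem_map_of_mem ?_
      obtain ⟨r₁, r₂⟩ := r
      rcases hstep with ⟨h₁, h₂⟩ | ⟨h₁, h₂⟩ | ⟨h₁, h₂⟩ <;> dsimp only at h₁ h₂ <;>
        subst h₁ h₂ <;> simp [ih]

theorem IsWarpingPath.mem_pathsFrom {m n : ℕ} {p : List (ℕ × ℕ)} (hp : IsWarpingPath m n p) :
    p ∈ pathsFrom m n (m + n) (1, 1) := by
  obtain ⟨hhead, hlast, hmem, hchain⟩ := isWarpingPath_iff_isChain.1 hp
  obtain ⟨t, rfl⟩ := List.head?_eq_some_iff.1 hhead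
  exact _root_.mem_pathsFrom _ _ _ (by dsimp only; omega) hlast
    (fun r hr => ⟨(hmem r hr).2.1, (hmem r hr).2.2.2⟩) hchain

theorem halve_xOne : halve [2, 8, 4, 6] = xOne := by
  norm_num [halve, xOne]

theorem halve_xTwo : halve [8, 4, 8, 10] = xTwo := by
  norm_num [halve, xTwo]

/-- The column-wise sum of `x⁽¹⁾` and `x⁽²⁾` along the warping path `p`. -/
def colSum (p : List (ℕ × ℕ)) : List ℤ :=
  p.map fun q => [1, 4, 2, 3].getD (q.1 - 1) 0 + [4, 2, 4, 5].getD (q.2 - 1) 0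

theorem halve_colSum (p : List (ℕ × ℕ)) : halve (colSum p) = colAverage p := by
  have h₁ (i : ℕ) : xOne.getD i 0 = (([1, 4, 2, 3].getD i 0 : ℤ) : ℚ) := by
    have := List.getD_map (l := [1, 4, 2, 3]) (d := 0) (n := i) (fun a : ℤ => (a : ℚ))
    simpa [xOne] using this
  have h₂ (i : ℕ) : xTwo.getD i 0 = (([4, 2, 4, 5].getD i 0 : ℤ) : ℚ) := by
    have := List.getD_map (l := [4, 2, 4, 5]) (d := 0) (n := i) (fun a : ℤ => (a : ℚ))
    simpa [xTwo] using this
  simp only [halve, colSum, colAverage, List.map_map]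
  refine List.map_congr_left fun q _ => ?_
  rw [h₁, h₂]
  push_cast [Function.comp]
  rfl

theorem lt_dtwBound_colSum :
    ∀ p ∈ pathsFrom 4 4 (4 + 4) (1, 1),
      26 < dtwBound (colSum p) [2, 8, 4, 6] + dtwBound (colSum p) [8, 4, 8, 10] := by
  decide +kernel

/-- `F((2.5,4,2,4)) = 6.5`, and for every warping path `p` of order `4 × 4`
the column-wise average of `x⁽¹⁾` and `x⁽²⁾` along `p` has Fréchet value
strictly larger than `6.5`; hence no such average is a mean. -/
theorem no_colAverage_is_mean :
    F [5/2, 4, 2, 4] = 6.5 ∧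
    ∀ p : List (ℕ × ℕ), IsWarpingPath 4 4 p → 6.5 < F (colAverage p) := by
  constructor
  · have hle₁ : dtwSq [5/2, 4, 2, 4] xOne ≤ _ :=
      dtwSq_le_alignCost (p := [(1, 1), (2, 2), (3, 3), (4, 4)])
        (isWarpingPath_iff_isChain.2 (by simp [xOne, WarpingStep]))
    have hle₂ : dtwSq [5/2, 4, 2, 4] xTwo ≤ _ :=
      dtwSq_le_alignCost (p := [(1, 1), (2, 1), (3, 2), (4, 3), (4, 4)])
        (isWarpingPath_iff_isChain.2 (by simp [xTwo, WarpingStep]))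
    have hz : halve [5, 8, 4, 8] = [5/2, 4, 2, 4] := by norm_num [halve]
    have hge₁ := dtwBound_le_dtwSq (X := [5, 8, 4, 8]) (Y := [2, 8, 4, 6]) (by simp) (by simp)
    have hge₂ := dtwBound_le_dtwSq (X := [5, 8, 4, 8]) (Y := [8, 4, 8, 10]) (by simp) (by simp)
    have h₁ : dtwBound [5, 8, 4, 8] [2, 8, 4, 6] = 13 := by decide +kernel
    have h₂ : dtwBound [5, 8, 4, 8] [8, 4, 8, 10] = 13 := by decide +kernel
    rw [h₁, hz, halve_xOne] at hge₁
    rw [h₂, hz, halve_xTwo] at hge₂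
    norm_num [alignCost, xOne, xTwo] at hle₁ hle₂ hge₁ hge₂
    norm_num [F, xOne, xTwo]
    linarith
  · intro p hp
    have hne : colSum p ≠ [] := by
      intro h
      simp [List.map_eq_nil_iff.1 h, IsWarpingPath] at hp
    have h₁ := dtwBound_le_dtwSq hne (Y := [2, 8, 4, 6]) (by simp)
    have h₂ := dtwBound_le_dtwSq hne (Y := [8, 4, 8, 10]) (by simp)
    rw [halve_colSum, halve_xOne] at h₁
    rw [halve_colSum, halve_xTwo] at h₂
    have h : ((26 : ℕ) : ℝ) < _ := Nat.cast_lt.2 (lt_dtwBound_colSum p hp.mem_pathsFrom)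
    push_cast at h
    unfold F
    linarith
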